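/- arXiv:2202.10807 — 14 statements merged into one kernel-verified Lean document; each statement's English description precedes it below -/
import Mathlib

section
/- Suppose K_n = 0 and α_s, α_n, K_s are arbitrary real numbers. Then H(ψ₁,ψ₂,ψ₃) = cot(ψ₁/2)·tan(ψ₃/2) is a first integral of the system ψ' = G(ψ): at every point ψ = (ψ₁,ψ₂,ψ₃) ∈ ℝ³ with sin(ψ₁/2) ≠ 0 and cos(ψ₃/2) ≠ 0, the orbital derivative vanishes, i.e. G₁(ψ)·∂H/∂ψ₁ + G₂(ψ)·∂H/∂ψ₂ + G₃(ψ)·∂H/∂ψ₃ = 0. -/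
open Real

noncomputable def G1 (Ks Kn as an ψ1 ψ2 ψ3 : ℝ) : ℝ :=
  -(Ks/2) * Real.cos as * Real.sin ψ1 + (Kn/4) *
    (Real.sin (an + ψ2) - Real.sin (an + ψ1 + ψ2)
      + Real.sin (an + ψ2 + ψ3) - Real.sin (an + ψ1 + ψ2 + ψ3))

noncomputable def G2 (Ks Kn as an ψ1 ψ2 ψ3 : ℝ) : ℝ :=
  (Ks/4) * (Real.sin (as + ψ3) - Real.sin (as - ψ1)) + (Kn/4) *
    (Real.sin (an - ψ1 - ψ2) - 2 * Real.cos an * Real.sin ψ2 - Real.sin (an + ψ2 + ψ3))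

noncomputable def G3 (Ks Kn as an ψ1 ψ2 ψ3 : ℝ) : ℝ :=
  -(Ks/2) * Real.cos as * Real.sin ψ3 + (Kn/4) *
    (-Real.sin (an - ψ2) - Real.sin (an - ψ1 - ψ2)
      + Real.sin (an - ψ2 - ψ3) + Real.sin (an - ψ1 - ψ2 - ψ3))

/-- For `K_n = 0`, `H(ψ) = cot(ψ₁/2)·tan(ψ₃/2)` is a first integral of `ψ' = G(ψ)`:
the orbital derivative vanishes wherever `H` is defined. -/
theorem stmt0 (Ks as an ψ1 ψ2 ψ3 : ℝ)
    (h1 : Real.sin (ψ1/2) ≠ 0) (h3 : Real.cos (ψ3/2) ≠ 0) :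
    G1 Ks 0 as an ψ1 ψ2 ψ3 * deriv (fun x => Real.cot (x/2) * Real.tan (ψ3/2)) ψ1
      + G2 Ks 0 as an ψ1 ψ2 ψ3 * deriv (fun _ : ℝ => Real.cot (ψ1/2) * Real.tan (ψ3/2)) ψ2
      + G3 Ks 0 as an ψ1 ψ2 ψ3 * deriv (fun x => Real.cot (ψ1/2) * Real.tan (x/2)) ψ3 = 0 := by
  have d1 : HasDerivAt (fun x => Real.cot (x/2) * Real.tan (ψ3/2))
      (-(1 / (2 * Real.sin (ψ1/2) ^ 2)) * Real.tan (ψ3/2)) ψ1 := by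
    have hh : HasDerivAt (fun x : ℝ => x / 2) (1 / 2) ψ1 := (hasDerivAt_id ψ1).div_const 2
    have hq := ((hh.cos).div (hh.sin) h1).mul_const (Real.tan (ψ3/2))
    have e : (fun x : ℝ => Real.cot (x/2) * Real.tan (ψ3/2))
        = fun x => Real.cos (x/2) / Real.sin (x/2) * Real.tan (ψ3/2) := by
      funext x
      rw [Real.cot_eq_cos_div_sin]
    rw [e]
    refine hq.congr_deriv ?_
    congr 1
    field_simp
    linear_combination -Real.sin_sq_add_cos_sq (ψ1/2)
  have d3 : HasDerivAt (fun x => Real.cot (ψ1/2) * Real.tan (x/2))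
      (Real.cot (ψ1/2) * (1 / (2 * Real.cos (ψ3/2) ^ 2))) ψ3 := by
    have hh : HasDerivAt (fun x : ℝ => x / 2) (1 / 2) ψ3 := (hasDerivAt_id ψ3).div_const 2
    have ht := ((Real.hasDerivAt_tan h3).comp ψ3 hh).const_mul (Real.cot (ψ1/2))
    refine ht.congr_deriv ?_
    congr 1
    field_simp
  have s1 : Real.sin ψ1 = 2 * Real.sin (ψ1/2) * Real.cos (ψ1/2) := by
    rw [← Real.sin_two_mul]; congr 1; ring
  have s3 : Real.sin ψ3 = 2 * Real.sin (ψ3/2) * Real.cos (ψ3/2) := by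
    rw [← Real.sin_two_mul]; congr 1; ring
  rw [d1.deriv, d3.deriv, deriv_const]
  unfold G1 G3
  rw [s1, s3, Real.cot_eq_cos_div_sin, Real.tan_eq_sin_div_cos]
  field_simp
  ring
end

section
/- Suppose K_n = 0 and α_s = 0 (K_s and α_n arbitrary real numbers). Then the linear function H(ψ₁,ψ₂,ψ₃) = ψ₁ + 2ψ₂ + ψ₃ is a first integral of the system ψ' = G(ψ): for every ψ ∈ ℝ³ one has G₁(ψ) + 2·G₂(ψ) + G₃(ψ) = 0; consequently, for every differentiable curve ψ : ℝ → ℝ³ with ψ'(t) = G(ψ(t)) for all t, the function t ↦ ψ₁(t) + 2ψ₂(t) + ψ₃(t) is constant. -/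
open Real

/-- For `K_n = 0`, `α_s = 0`, the linear function `ψ₁ + 2ψ₂ + ψ₃` is a first integral. -/
theorem stmt1 (Ks an : ℝ) :
    (∀ ψ1 ψ2 ψ3 : ℝ,
      G1 Ks 0 0 an ψ1 ψ2 ψ3 + 2 * G2 Ks 0 0 an ψ1 ψ2 ψ3 + G3 Ks 0 0 an ψ1 ψ2 ψ3 = 0) ∧
    (∀ p1 p2 p3 : ℝ → ℝ,
      (∀ t, HasDerivAt p1 (G1 Ks 0 0 an (p1 t) (p2 t) (p3 t)) t) →
      (∀ t, HasDerivAt p2 (G2 Ks 0 0 an (p1 t) (p2 t) (p3 t)) t) →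
      (∀ t, HasDerivAt p3 (G3 Ks 0 0 an (p1 t) (p2 t) (p3 t)) t) →
      ∀ s t : ℝ, p1 s + 2 * p2 s + p3 s = p1 t + 2 * p2 t + p3 t) := by
  have key : ∀ ψ1 ψ2 ψ3 : ℝ,
      G1 Ks 0 0 an ψ1 ψ2 ψ3 + 2 * G2 Ks 0 0 an ψ1 ψ2 ψ3 + G3 Ks 0 0 an ψ1 ψ2 ψ3 = 0 := by
    intro ψ1 ψ2 ψ3
    simp only [G1, G2, G3, Real.cos_zero, zero_add, zero_sub, Real.sin_neg]
    ring
  refine ⟨key, ?_⟩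
  intro p1 p2 p3 h1 h2 h3 s t
  have hd : ∀ x, HasDerivAt (fun x => p1 x + 2 * p2 x + p3 x) 0 x := by
    intro x
    have h := ((h1 x).add ((h2 x).const_mul 2)).add (h3 x)
    rw [key] at h
    exact h
  exact is_const_of_deriv_eq_zero (fun x => (hd x).differentiableAt)
    (fun x => (hd x).deriv) s t
end

section
/- Suppose K_s = 0 and α_s = α_n = 0 (K_n an arbitrary real number). Then H(ψ₁,ψ₂,ψ₃) = cot((ψ₁+ψ₃)/4)·tan((ψ₁−ψ₃)/4) is a first integral of the system ψ' = G(ψ): at every point ψ = (ψ₁,ψ₂,ψ₃) ∈ ℝ³ with sin((ψ₁+ψ₃)/4) ≠ 0 and cos((ψ₁−ψ₃)/4) ≠ 0, the orbital derivative vanishes, i.e. G₁(ψ)·∂H/∂ψ₁ + G₂(ψ)·∂H/∂ψ₂ + G₃(ψ)·∂H/∂ψ₃ = 0. -/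
open Real

theorem H_deriv (f g : ℝ → ℝ) (f' g' x : ℝ) (hf : HasDerivAt f f' x) (hg : HasDerivAt g g' x)
    (h1 : Real.sin (f x) ≠ 0) (h2 : Real.cos (g x) ≠ 0) :
    deriv (fun x => Real.cot (f x) * Real.tan (g x)) x =
      (Real.sin (f x) * Real.cos (f x) * g' - Real.sin (g x) * Real.cos (g x) * f')
        / (Real.sin (f x) ^ 2 * Real.cos (g x) ^ 2) := by
  have h := ((hf.cos.div hf.sin h1).mul (hg.sin.div hg.cos h2)).deriv
  have e : (fun x => Real.cot (f x) * Real.tan (g x)) =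
      (((fun x => Real.cos (f x)) / (fun x => Real.sin (f x))) *
        ((fun x => Real.sin (g x)) / (fun x => Real.cos (g x)))) := by
    funext y
    simp [Real.cot_eq_cos_div_sin, Real.tan_eq_sin_div_cos]
  rw [e, h]
  simp only [Pi.div_apply]
  have a := Real.sin_sq_add_cos_sq (f x)
  have b := Real.sin_sq_add_cos_sq (g x)
  field_simp
  linear_combination (-Real.sin (g x) * Real.cos (g x) * f') * a
    + Real.sin (f x) * Real.cos (f x) * g' * b

theorem trig_id (u v a : ℝ) :
    Real.sin (2*v) * (Real.sin a - Real.sin (a + 4*u)) =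
      Real.sin (2*u) * (Real.sin (a + (2*u-2*v)) - Real.sin (a + (2*u+2*v))) := by
  have e1 : Real.sin a = Real.sin ((a+2*u) - 2*u) := by ring_nf
  have e2 : Real.sin (a+4*u) = Real.sin ((a+2*u) + 2*u) := by ring_nf
  have e3 : Real.sin (a+(2*u-2*v)) = Real.sin ((a+2*u) - 2*v) := by ring_nf
  have e4 : Real.sin (a+(2*u+2*v)) = Real.sin ((a+2*u) + 2*v) := by ring_nf
  rw [e1, e2, e3, e4, Real.sin_sub _ (2*u), Real.sin_add (a+2*u) (2*u),
    Real.sin_sub _ (2*v), Real.sin_add (a+2*u) (2*v)]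
  ring

/-- For `K_s = 0`, `α_s = α_n = 0`, `H(ψ) = cot((ψ₁+ψ₃)/4)·tan((ψ₁−ψ₃)/4)` is a first
integral: the orbital derivative vanishes wherever `H` is defined. -/
theorem stmt2 (Kn ψ1 ψ2 ψ3 : ℝ)
    (h1 : Real.sin ((ψ1 + ψ3)/4) ≠ 0) (h2 : Real.cos ((ψ1 - ψ3)/4) ≠ 0) :
    G1 0 Kn 0 0 ψ1 ψ2 ψ3 * deriv (fun x => Real.cot ((x + ψ3)/4) * Real.tan ((x - ψ3)/4)) ψ1
      + G2 0 Kn 0 0 ψ1 ψ2 ψ3 *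
          deriv (fun _ : ℝ => Real.cot ((ψ1 + ψ3)/4) * Real.tan ((ψ1 - ψ3)/4)) ψ2
      + G3 0 Kn 0 0 ψ1 ψ2 ψ3 *
          deriv (fun x => Real.cot ((ψ1 + x)/4) * Real.tan ((ψ1 - x)/4)) ψ3 = 0 := by
  rw [H_deriv (fun x => (x + ψ3)/4) (fun x => (x - ψ3)/4) (1/4) (1/4) ψ1
      (((hasDerivAt_id ψ1).add_const ψ3).div_const 4)
      (((hasDerivAt_id ψ1).sub_const ψ3).div_const 4) h1 h2,
    H_deriv (fun x => (ψ1 + x)/4) (fun x => (ψ1 - x)/4) (1/4) (-1/4) ψ3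
      (((hasDerivAt_id ψ3).const_add ψ1).div_const 4)
      (((hasDerivAt_id ψ3).const_sub ψ1).div_const 4) h1 h2, deriv_const]
  obtain ⟨u, hu⟩ : ∃ u, u = (ψ1 + ψ3)/4 := ⟨_, rfl⟩
  obtain ⟨v, hv⟩ : ∃ v, v = (ψ1 - ψ3)/4 := ⟨_, rfl⟩
  have p1 : ψ1 = 2*u + 2*v := by rw [hu, hv]; ring
  have p3 : ψ3 = 2*u - 2*v := by rw [hu, hv]; ring
  have k := trig_id u v ψ2
  rw [← p1, ← p3, Real.sin_two_mul, Real.sin_two_mul] at k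
  have q1 : 0 + ψ1 + ψ2 = ψ2 + ψ1 := by ring
  have q2 : 0 + ψ1 + ψ2 + ψ3 = ψ2 + 4*u := by rw [hu]; ring
  have q3 : 0 - ψ1 - ψ2 = -(ψ2 + ψ1) := by ring
  have q4 : 0 - ψ2 - ψ3 = -(ψ2 + ψ3) := by ring
  have q5 : 0 - ψ1 - ψ2 - ψ3 = -(ψ2 + 4*u) := by rw [hu]; ring
  simp only [G1, G3]
  rw [q2, q1, q5, q3, q4, zero_add, zero_sub]
  simp only [Real.sin_neg, ← hu, ← hv]
  rw [← hu] at h1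
  rw [← hv] at h2
  field_simp
  linear_combination (-2*Kn) * k
end

section
/- Suppose α_s = α_n = π/2 (K_s and K_n arbitrary real numbers). Then H(ψ₁,ψ₂,ψ₃) = sin(ψ₁/2)·sin(ψ₃/2) is a first integral of the system ψ' = G(ψ): for every ψ ∈ ℝ³ the orbital derivative vanishes, i.e. G₁(ψ)·∂H/∂ψ₁ + G₂(ψ)·∂H/∂ψ₂ + G₃(ψ)·∂H/∂ψ₃ = 0; consequently, for every differentiable curve ψ : ℝ → ℝ³ with ψ'(t) = G(ψ(t)) for all t, the function t ↦ sin(ψ₁(t)/2)·sin(ψ₃(t)/2) is constant. -/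
open Real

lemma G1_half (Ks Kn x y z : ℝ) : G1 Ks Kn (π/2) (π/2) x y z
    = Kn * sin (x/2) * cos (z/2) * sin (y + x/2 + z/2) := by
  obtain ⟨a, rfl⟩ : ∃ a, x = 2 * a := ⟨x/2, by ring⟩
  obtain ⟨c, rfl⟩ : ∃ c, z = 2 * c := ⟨z/2, by ring⟩
  obtain ⟨m, rfl⟩ : ∃ m, y = m - a - c := ⟨y + a + c, by ring⟩
  have e1 : sin (π/2 + (m - a - c)) = cos (m - a - c) := by
    rw [add_comm, sin_add_pi_div_two]
  have e2 : sin (π/2 + 2*a + (m - a - c)) = cos (m + a - c) := by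
    rw [← sin_add_pi_div_two]; congr 1; ring
  have e3 : sin (π/2 + (m - a - c) + 2*c) = cos (m - a + c) := by
    rw [← sin_add_pi_div_two]; congr 1; ring
  have e4 : sin (π/2 + 2*a + (m - a - c) + 2*c) = cos (m + a + c) := by
    rw [← sin_add_pi_div_two]; congr 1; ring
  have e5 : m - a - c + 2*a/2 + 2*c/2 = m := by ring
  have e6 : 2*a/2 = a := by ring
  have e7 : 2*c/2 = c := by ring
  rw [G1, e1, e2, e3, e4, e5, e6, e7, cos_pi_div_two]
  simp only [cos_add, cos_sub, sin_add, sin_sub]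
  ring

lemma G3_half (Ks Kn x y z : ℝ) : G3 Ks Kn (π/2) (π/2) x y z
    = -(Kn * cos (x/2) * sin (z/2) * sin (y + x/2 + z/2)) := by
  obtain ⟨a, rfl⟩ : ∃ a, x = 2 * a := ⟨x/2, by ring⟩
  obtain ⟨c, rfl⟩ : ∃ c, z = 2 * c := ⟨z/2, by ring⟩
  obtain ⟨m, rfl⟩ : ∃ m, y = m - a - c := ⟨y + a + c, by ring⟩
  have e1 : sin (π/2 - (m - a - c)) = cos (m - a - c) := sin_pi_div_two_sub _
  have e2 : sin (π/2 - 2*a - (m - a - c)) = cos (m + a - c) := by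
    rw [← sin_pi_div_two_sub]; congr 1; ring
  have e3 : sin (π/2 - (m - a - c) - 2*c) = cos (m - a + c) := by
    rw [← sin_pi_div_two_sub]; congr 1; ring
  have e4 : sin (π/2 - 2*a - (m - a - c) - 2*c) = cos (m + a + c) := by
    rw [← sin_pi_div_two_sub]; congr 1; ring
  have e5 : m - a - c + 2*a/2 + 2*c/2 = m := by ring
  have e6 : 2*a/2 = a := by ring
  have e7 : 2*c/2 = c := by ring
  rw [G3, e1, e2, e3, e4, e5, e6, e7, cos_pi_div_two]
  simp only [cos_add, cos_sub, sin_add, sin_sub]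
  ring

/-- For `α_s = α_n = π/2`, `H(ψ) = sin(ψ₁/2)·sin(ψ₃/2)` is a first integral. -/
theorem stmt3 (Ks Kn : ℝ) :
    (∀ ψ1 ψ2 ψ3 : ℝ,
      G1 Ks Kn (π/2) (π/2) ψ1 ψ2 ψ3 * deriv (fun x => Real.sin (x/2) * Real.sin (ψ3/2)) ψ1
        + G2 Ks Kn (π/2) (π/2) ψ1 ψ2 ψ3 *
            deriv (fun _ : ℝ => Real.sin (ψ1/2) * Real.sin (ψ3/2)) ψ2
        + G3 Ks Kn (π/2) (π/2) ψ1 ψ2 ψ3 *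
            deriv (fun x => Real.sin (ψ1/2) * Real.sin (x/2)) ψ3 = 0) ∧
    (∀ p1 p2 p3 : ℝ → ℝ,
      (∀ t, HasDerivAt p1 (G1 Ks Kn (π/2) (π/2) (p1 t) (p2 t) (p3 t)) t) →
      (∀ t, HasDerivAt p2 (G2 Ks Kn (π/2) (π/2) (p1 t) (p2 t) (p3 t)) t) →
      (∀ t, HasDerivAt p3 (G3 Ks Kn (π/2) (π/2) (p1 t) (p2 t) (p3 t)) t) →
      ∀ s t : ℝ,
        Real.sin (p1 s / 2) * Real.sin (p3 s / 2)
          = Real.sin (p1 t / 2) * Real.sin (p3 t / 2)) := by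
  constructor
  · intro x y z
    have hs : ∀ u : ℝ, HasDerivAt (fun x : ℝ => Real.sin (x/2)) (Real.cos (u/2) * (1/2)) u :=
      fun u => ((hasDerivAt_id u).div_const 2).sin
    rw [((hs x).mul_const _).deriv, ((hs z).const_mul _).deriv, deriv_const, G1_half, G3_half]
    ring
  · intro p1 p2 p3 h1 _ h3 s t
    have hd : ∀ u, HasDerivAt (fun t => Real.sin (p1 t / 2) * Real.sin (p3 t / 2)) 0 u := by
      intro u
      have h := (((h1 u).div_const 2).sin).mul (((h3 u).div_const 2).sin)
      refine h.congr_deriv ?_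
      rw [G1_half, G3_half]
      ring
    exact is_const_of_deriv_eq_zero (fun u => (hd u).differentiableAt) (fun u => (hd u).deriv) s t
end

section
/- Suppose K_s = 0 and α_n = π/2 (K_n and α_s arbitrary real numbers). Then the linear function H(ψ₁,ψ₂,ψ₃) = ψ₁ + 2ψ₂ + ψ₃ is a first integral of the system ψ' = G(ψ): for every ψ ∈ ℝ³ one has G₁(ψ) + 2·G₂(ψ) + G₃(ψ) = 0; consequently, for every differentiable curve ψ : ℝ → ℝ³ with ψ'(t) = G(ψ(t)) for all t, the function t ↦ ψ₁(t) + 2ψ₂(t) + ψ₃(t) is constant. -/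
open Real

/-- For `K_s = 0`, `α_n = π/2`, the linear function `ψ₁ + 2ψ₂ + ψ₃` is a first integral. -/
theorem stmt4 (Kn as : ℝ) :
    (∀ ψ1 ψ2 ψ3 : ℝ,
      G1 0 Kn as (π/2) ψ1 ψ2 ψ3 + 2 * G2 0 Kn as (π/2) ψ1 ψ2 ψ3
        + G3 0 Kn as (π/2) ψ1 ψ2 ψ3 = 0) ∧
    (∀ p1 p2 p3 : ℝ → ℝ,
      (∀ t, HasDerivAt p1 (G1 0 Kn as (π/2) (p1 t) (p2 t) (p3 t)) t) →
      (∀ t, HasDerivAt p2 (G2 0 Kn as (π/2) (p1 t) (p2 t) (p3 t)) t) →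
      (∀ t, HasDerivAt p3 (G3 0 Kn as (π/2) (p1 t) (p2 t) (p3 t)) t) →
      ∀ s t : ℝ, p1 s + 2 * p2 s + p3 s = p1 t + 2 * p2 t + p3 t) := by
  have key : ∀ ψ1 ψ2 ψ3 : ℝ,
      G1 0 Kn as (π/2) ψ1 ψ2 ψ3 + 2 * G2 0 Kn as (π/2) ψ1 ψ2 ψ3
        + G3 0 Kn as (π/2) ψ1 ψ2 ψ3 = 0 := by
    intro a b c
    unfold G1 G2 G3
    have e1 : π/2 + a + b = (a + b) + π/2 := by ring
    have e2 : π/2 + b + c = (b + c) + π/2 := by ring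
    have e3 : π/2 + a + b + c = (a + b + c) + π/2 := by ring
    have e4 : π/2 - a - b = π/2 - (a + b) := by ring
    have e5 : π/2 - b - c = π/2 - (b + c) := by ring
    have e6 : π/2 - a - b - c = π/2 - (a + b + c) := by ring
    rw [e3, e6, e1, e2, e4, e5, add_comm (π/2) b]
    simp only [Real.sin_add_pi_div_two, Real.sin_pi_div_two_sub, Real.cos_pi_div_two]
    ring
  refine ⟨key, ?_⟩
  intro p1 p2 p3 h1 h2 h3 s t
  have hd : ∀ x, HasDerivAt (fun x => p1 x + 2 * p2 x + p3 x) 0 x := by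
    intro x
    have h := ((h1 x).add ((h2 x).const_mul 2)).add (h3 x)
    rw [key] at h
    exact h
  exact is_const_of_deriv_eq_zero (fun x => (hd x).differentiableAt)
    (fun x => (hd x).deriv) s t
end

section
/- Suppose α_s = π/2 and α_n = 0 (K_s and K_n arbitrary real numbers). Then H(ψ₁,ψ₂,ψ₃) = cot((ψ₁+ψ₃)/4)·tan((ψ₁−ψ₃)/4) is a first integral of the system ψ' = G(ψ): at every point ψ = (ψ₁,ψ₂,ψ₃) ∈ ℝ³ with sin((ψ₁+ψ₃)/4) ≠ 0 and cos((ψ₁−ψ₃)/4) ≠ 0, the orbital derivative vanishes, i.e. G₁(ψ)·∂H/∂ψ₁ + G₂(ψ)·∂H/∂ψ₂ + G₃(ψ)·∂H/∂ψ₃ = 0. -/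
open Real

theorem cot_hasDerivAt_aux {f : ℝ → ℝ} {f' x : ℝ} (h : Real.sin (f x) ≠ 0)
    (hf : HasDerivAt f f' x) :
    HasDerivAt (fun y => Real.cot (f y)) (-f' / Real.sin (f x) ^ 2) x := by
  have e : (fun y => Real.cot (f y)) = fun y => Real.cos (f y) / Real.sin (f y) := by
    funext y; exact Real.cot_eq_cos_div_sin _
  rw [e]
  refine (hf.cos.div hf.sin h).congr_deriv ?_
  have key := Real.sin_sq_add_cos_sq (f x)
  field_simp
  linear_combination (-f') * key

theorem tan_hasDerivAt_aux {f : ℝ → ℝ} {f' x : ℝ} (h : Real.cos (f x) ≠ 0)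
    (hf : HasDerivAt f f' x) :
    HasDerivAt (fun y => Real.tan (f y)) (f' / Real.cos (f x) ^ 2) x := by
  refine ((Real.hasDerivAt_tan h).comp x hf).congr_deriv ?_
  ring

/-- For `α_s = π/2`, `α_n = 0`, `H(ψ) = cot((ψ₁+ψ₃)/4)·tan((ψ₁−ψ₃)/4)` is a first
integral: the orbital derivative vanishes wherever `H` is defined. -/
theorem stmt5 (Ks Kn ψ1 ψ2 ψ3 : ℝ)
    (h1 : Real.sin ((ψ1 + ψ3)/4) ≠ 0) (h2 : Real.cos ((ψ1 - ψ3)/4) ≠ 0) :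
    G1 Ks Kn (π/2) 0 ψ1 ψ2 ψ3 *
        deriv (fun x => Real.cot ((x + ψ3)/4) * Real.tan ((x - ψ3)/4)) ψ1
      + G2 Ks Kn (π/2) 0 ψ1 ψ2 ψ3 *
          deriv (fun _ : ℝ => Real.cot ((ψ1 + ψ3)/4) * Real.tan ((ψ1 - ψ3)/4)) ψ2
      + G3 Ks Kn (π/2) 0 ψ1 ψ2 ψ3 *
          deriv (fun x => Real.cot ((ψ1 + x)/4) * Real.tan ((ψ1 - x)/4)) ψ3 = 0 := by
  have hA : HasDerivAt (fun x => Real.cot ((x + ψ3)/4) * Real.tan ((x - ψ3)/4)) _ ψ1 :=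
    (cot_hasDerivAt_aux (f := fun x => (x + ψ3)/4) h1 (((hasDerivAt_id ψ1).add_const ψ3).div_const 4)).mul
      (tan_hasDerivAt_aux (f := fun x => (x - ψ3)/4) h2 (((hasDerivAt_id ψ1).sub_const ψ3).div_const 4))
  have hB : HasDerivAt (fun x => Real.cot ((ψ1 + x)/4) * Real.tan ((ψ1 - x)/4)) _ ψ3 :=
    (cot_hasDerivAt_aux (f := fun x => (ψ1 + x)/4) h1 (((hasDerivAt_id ψ3).const_add ψ1).div_const 4)).mul
      (tan_hasDerivAt_aux (f := fun x => (ψ1 - x)/4) h2 (((hasDerivAt_id ψ3).const_sub ψ1).div_const 4))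
  rw [hA.deriv, hB.deriv, deriv_const]
  obtain ⟨u, hu⟩ : ∃ u, u = (ψ1 + ψ3)/4 := ⟨_, rfl⟩
  obtain ⟨v, hv⟩ : ∃ v, v = (ψ1 - ψ3)/4 := ⟨_, rfl⟩
  obtain ⟨w, hw⟩ : ∃ w, w = ψ2 + 2*u := ⟨_, rfl⟩
  rw [← hu] at h1
  rw [← hv] at h2
  have e1 : G1 Ks Kn (π/2) 0 ψ1 ψ2 ψ3 + G3 Ks Kn (π/2) 0 ψ1 ψ2 ψ3
      = -2 * Kn * Real.cos w * (Real.sin u * Real.cos u) := by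
    have a1 : ψ1 = 2*u + 2*v := by linarith
    have a3 : ψ3 = 2*u - 2*v := by linarith
    have a2 : ψ2 = w - 2*u := by linarith
    subst a1 a3 a2
    simp only [G1, G3, Real.cos_pi_div_two]
    ring_nf
    simp only [Real.sin_add, Real.sin_sub, Real.sin_neg, Real.cos_neg, Real.cos_add, Real.cos_sub,
      mul_comm _ (2:ℝ), Real.sin_two_mul]
    ring_nf
  have e2 : G1 Ks Kn (π/2) 0 ψ1 ψ2 ψ3 - G3 Ks Kn (π/2) 0 ψ1 ψ2 ψ3
      = -2 * Kn * Real.cos w * (Real.sin v * Real.cos v) := by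
    have a1 : ψ1 = 2*u + 2*v := by linarith
    have a3 : ψ3 = 2*u - 2*v := by linarith
    have a2 : ψ2 = w - 2*u := by linarith
    subst a1 a3 a2
    simp only [G1, G3, Real.cos_pi_div_two]
    ring_nf
    simp only [Real.sin_add, Real.sin_sub, Real.sin_neg, Real.cos_neg, Real.cos_add, Real.cos_sub,
      mul_comm _ (2:ℝ), Real.sin_two_mul]
    ring_nf
  rw [← hu, ← hv, Real.cot_eq_cos_div_sin, Real.tan_eq_sin_div_cos]
  generalize G1 Ks Kn (π/2) 0 ψ1 ψ2 ψ3 = g1 at *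
  generalize G3 Ks Kn (π/2) 0 ψ1 ψ2 ψ3 = g3 at *
  have b1 : g1 = (-2 * Kn * Real.cos w * (Real.sin u * Real.cos u)
    + -2 * Kn * Real.cos w * (Real.sin v * Real.cos v)) / 2 := by linarith
  have b3 : g3 = (-2 * Kn * Real.cos w * (Real.sin u * Real.cos u)
    - -2 * Kn * Real.cos w * (Real.sin v * Real.cos v)) / 2 := by linarith
  rw [b1, b3]
  field_simp
  ring
end

section
/- Suppose α_s = α_n = π/2 (K_s and K_n arbitrary real numbers). Then the vector field G is divergence-free: for every ψ ∈ ℝ³, ∂G₁/∂ψ₁(ψ) + ∂G₂/∂ψ₂(ψ) + ∂G₃/∂ψ₃(ψ) = 0. -/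
open Real

/-- For `α_s = α_n = π/2` the vector field `G` is divergence-free. -/
theorem stmt8 (Ks Kn ψ1 ψ2 ψ3 : ℝ) :
    deriv (fun x => G1 Ks Kn (π/2) (π/2) x ψ2 ψ3) ψ1
      + deriv (fun x => G2 Ks Kn (π/2) (π/2) ψ1 x ψ3) ψ2
      + deriv (fun x => G3 Ks Kn (π/2) (π/2) ψ1 ψ2 x) ψ3 = 0 := by
  have key : ∀ c y : ℝ, HasDerivAt (fun x => Real.cos (c + x)) (-Real.sin (c + y)) y := by
    intro c y
    simpa using ((hasDerivAt_id y).const_add c).cos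
  have e1 : (fun x => G1 Ks Kn (π/2) (π/2) x ψ2 ψ3) = fun x => (Kn/4) *
      (Real.cos ψ2 - Real.cos (ψ2 + x) + Real.cos (ψ2 + ψ3) - Real.cos (ψ2 + ψ3 + x)) := by
    funext x
    simp only [G1, add_assoc, sin_add (π/2), sin_pi_div_two, cos_pi_div_two]
    rw [show ψ2 + (ψ3 + x) = x + (ψ2 + ψ3) by ring, add_comm ψ2 x]
    ring
  have e2 : (fun x => G2 Ks Kn (π/2) (π/2) ψ1 x ψ3) = fun x =>
      (Ks/4) * (Real.cos ψ3 - Real.cos ψ1) + (Kn/4) *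
      (Real.cos (ψ1 + x) - Real.cos (ψ3 + x)) := by
    funext x
    simp only [G2, add_assoc, sub_sub, sin_add (π/2), sin_sub (π/2), sin_pi_div_two,
      cos_pi_div_two]
    rw [add_comm ψ3 x]
    ring
  have e3 : (fun x => G3 Ks Kn (π/2) (π/2) ψ1 ψ2 x) = fun x => (Kn/4) *
      (-Real.cos ψ2 - Real.cos (ψ1 + ψ2) + Real.cos (ψ2 + x) + Real.cos (ψ1 + ψ2 + x)) := by
    funext x
    simp only [G3, sub_sub, sin_sub (π/2), sin_pi_div_two, cos_pi_div_two]
    ring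
  have d1 := ((((key ψ2 ψ1).const_sub (Real.cos ψ2)).add_const (Real.cos (ψ2 + ψ3))).sub
    (key (ψ2 + ψ3) ψ1)).const_mul (Kn/4)
  have d2 := (((key ψ1 ψ2).sub (key ψ3 ψ2)).const_mul (Kn/4)).const_add
    ((Ks/4) * (Real.cos ψ3 - Real.cos ψ1))
  have d3 := (((key ψ2 ψ3).const_add (-Real.cos ψ2 - Real.cos (ψ1 + ψ2))).add
    (key (ψ1 + ψ2) ψ3)).const_mul (Kn/4)
  rw [e1, e2, e3]
  erw [d1.deriv, d2.deriv, d3.deriv]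
  rw [add_comm ψ2 ψ1, add_comm ψ3 ψ2, show ψ2 + ψ3 + ψ1 = ψ1 + ψ2 + ψ3 by ring]
  ring
end

section
/- Let M, N ≥ 1 and let g_s, g_n : ℝ → ℝ be differentiable even functions (g_s(−x) = g_s(x) and g_n(−x) = g_n(x)). Then the vector field of the system of M populations of N oscillators is divergence-free: for every θ ∈ ℝ^{MN}, the sum over all (σ,k) of the partial derivative with respect to θ_{σ,k} of the component ω + (1/(MN))·(∑_{j=1}^{N} g_s(θ_{σ,j}−θ_{σ,k}) + ∑_{τ≠σ}∑_{j=1}^{N} g_n(θ_{τ,j}−θ_{σ,k})) equals zero. -/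
open Real

theorem odd_deriv_of_even (g : ℝ → ℝ) (h : ∀ x, g (-x) = g x) (x : ℝ) :
    deriv g (-x) = - deriv g x := by
  have h1 := deriv_comp_neg g x
  have h2 : (fun y => g (-y)) = g := funext h
  rw [h2] at h1
  linarith

theorem sum_antisymm {ι : Type*} [Fintype ι] (f : ι → ι → ℝ) (h : ∀ a b, f a b = - f b a) :
    ∑ a, ∑ b, f a b = 0 := by
  have h1 : ∑ a, ∑ b, f a b = - ∑ a, ∑ b, f a b := by
    conv_lhs => rw [Finset.sum_comm]
    simp only [← Finset.sum_neg_distrib]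
    exact Finset.sum_congr rfl fun a _ => Finset.sum_congr rfl fun b _ => h b a
  linarith

/-- For differentiable even coupling functions `g_s, g_n`, the vector field of the system
of `M` populations of `N` oscillators is divergence-free. -/
theorem stmt9 (M N : ℕ) (hM : 1 ≤ M) (hN : 1 ≤ N) (ω : ℝ)
    (gs gn : ℝ → ℝ) (hgs : Differentiable ℝ gs) (hgn : Differentiable ℝ gn)
    (hgs_even : ∀ x, gs (-x) = gs x) (hgn_even : ∀ x, gn (-x) = gn x)
    (θ : Fin M → Fin N → ℝ) :
    ∑ σ : Fin M, ∑ k : Fin N,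
      deriv (fun x =>
        let θ' := Function.update θ σ (Function.update (θ σ) k x)
        ω + (1/((M : ℝ) * (N : ℝ))) *
          ((∑ j, gs (θ' σ j - θ' σ k))
            + ∑ τ ∈ Finset.univ \ {σ}, ∑ j, gn (θ' τ j - θ' σ k))) (θ σ k) = 0 := by
  set G : (Fin M × Fin N) → (Fin M × Fin N) → ℝ := fun a b =>
    if b.1 = a.1 then deriv gs (θ b.1 b.2 - θ a.1 a.2)
    else deriv gn (θ b.1 b.2 - θ a.1 a.2) with hG
  have os := odd_deriv_of_even gs hgs_even
  have on := odd_deriv_of_even gn hgn_even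
  have hanti : ∀ a b, G a b = - G b a := by
    intro a b
    simp only [hG]
    by_cases hab : b.1 = a.1
    · rw [if_pos hab, if_pos hab.symm, ← os, neg_sub]
    · rw [if_neg hab, if_neg (Ne.symm hab), ← on, neg_sub]
  have hd : ∀ (g : ℝ → ℝ), Differentiable ℝ g → ∀ c x : ℝ,
      HasDerivAt (fun x => g (c - x)) (- deriv g (c - x)) x := by
    intro g hg c x
    have h1 := (hg (c - x)).hasDerivAt.comp x ((hasDerivAt_id x).const_sub c)
    simpa [Function.comp_def] using h1
  have key : ∀ σ k, deriv (fun x =>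
        let θ' := Function.update θ σ (Function.update (θ σ) k x)
        ω + (1/((M : ℝ) * (N : ℝ))) *
          ((∑ j, gs (θ' σ j - θ' σ k))
            + ∑ τ ∈ Finset.univ \ {σ}, ∑ j, gn (θ' τ j - θ' σ k))) (θ σ k)
      = (1/((M : ℝ) * (N : ℝ))) * (- ∑ b, G (σ, k) b) := by
    intro σ k
    have hs : ∀ j, HasDerivAt (fun x => gs (Function.update (θ σ) k x j - x))
        (- deriv gs (θ σ j - θ σ k)) (θ σ k) := by
      intro j
      by_cases hj : j = k
      · subst hj
        have h0 : deriv gs 0 = 0 := by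
          have := os 0
          rw [neg_zero] at this
          linarith
        simpa [h0] using hasDerivAt_const (θ σ j) (gs 0)
      · simpa [Function.update_of_ne hj] using hd gs hgs (θ σ j) (θ σ k)
    have hn : ∀ τ ∈ Finset.univ \ {σ}, HasDerivAt
        (fun x => ∑ j, gn (Function.update θ σ (Function.update (θ σ) k x) τ j - x))
        (∑ j, - deriv gn (θ τ j - θ σ k)) (θ σ k) := by
      intro τ hτ
      have hne : τ ≠ σ := by simpa using hτ
      simp only [Function.update_of_ne hne]
      exact HasDerivAt.fun_sum fun j _ => hd gn hgn (θ τ j) (θ σ k)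
    have H := (((HasDerivAt.fun_sum (u := Finset.univ) fun j _ => hs j).add
      (HasDerivAt.fun_sum hn)).const_mul (1/((M : ℝ) * (N : ℝ)))).const_add ω
    simp only [Function.update_self]
    refine H.deriv.trans ?_
    congr 1
    rw [Fintype.sum_prod_type, ← Finset.sum_sdiff (Finset.subset_univ {σ}),
      Finset.sum_singleton, neg_add, add_comm]
    simp only [← Finset.sum_neg_distrib]
    congr 1
    · refine Finset.sum_congr rfl fun τ hτ => Finset.sum_congr rfl fun j _ => ?_
      have hne : τ ≠ σ := by simpa using hτ
      simp [hG, hne]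
    · simp [hG]
  simp only [key]
  have := sum_antisymm G hanti
  rw [Fintype.sum_prod_type] at this
  simp only [← Finset.mul_sum, Finset.sum_neg_distrib, this, neg_zero, mul_zero]
end

section
/- For arbitrary real parameters K_s, K_n, α_s, α_n, the vector field G is equivariant under the linear maps γ_r(ψ₁,ψ₂,ψ₃) = (−ψ₃, −ψ₁−ψ₂, ψ₁) and γ_m(ψ₁,ψ₂,ψ₃) = (ψ₁, ψ₂+ψ₃, −ψ₃): for every ψ ∈ ℝ³, G(γ_r(ψ)) = γ_r(G(ψ)) and G(γ_m(ψ)) = γ_m(G(ψ)). (These two maps generate the dihedral symmetry group D₄ of the network.) -/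
open Real

/-- The vector field `G` as a self-map of `ℝ³`. -/
noncomputable def Gv (Ks Kn as an : ℝ) (p : ℝ × ℝ × ℝ) : ℝ × ℝ × ℝ :=
  (G1 Ks Kn as an p.1 p.2.1 p.2.2,
   G2 Ks Kn as an p.1 p.2.1 p.2.2,
   G3 Ks Kn as an p.1 p.2.1 p.2.2)

/-- Rotation generator of `D₄` in phase-difference coordinates. -/
def gammaR (p : ℝ × ℝ × ℝ) : ℝ × ℝ × ℝ := (-p.2.2, -p.1 - p.2.1, p.1)

/-- Mirror generator of `D₄` in phase-difference coordinates. -/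
def gammaM (p : ℝ × ℝ × ℝ) : ℝ × ℝ × ℝ := (p.1, p.2.1 + p.2.2, -p.2.2)

/-- For arbitrary parameters, `G` is equivariant with respect to the generators
`γ_r`, `γ_m` of the dihedral group `D₄`. -/
theorem stmt10 (Ks Kn as an : ℝ) (p : ℝ × ℝ × ℝ) :
    Gv Ks Kn as an (gammaR p) = gammaR (Gv Ks Kn as an p) ∧
    Gv Ks Kn as an (gammaM p) = gammaM (Gv Ks Kn as an p) := by
  obtain ⟨a, b, c⟩ := p
  simp only [Gv, gammaR, gammaM, G1, G2, G3, Prod.mk.injEq]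
  refine ⟨⟨?_, ?_, ?_⟩, ?_, ?_, ?_⟩ <;>
  · simp only [sub_eq_add_neg, neg_add, neg_neg, Real.sin_add, Real.cos_add, Real.sin_neg,
      Real.cos_neg]
    have hc := Real.sin_sq_add_cos_sq c
    have ha := Real.sin_sq_add_cos_sq a
    grind
end

section
/- Suppose α_s = α_n = π/2 (K_s and K_n arbitrary real numbers). Then the system ψ' = G(ψ) has the time-reversing symmetry R(ψ₁,ψ₂,ψ₃) = (ψ₃, ψ₂, ψ₁): for every ψ ∈ ℝ³, G(R(ψ)) = −R(G(ψ)); consequently, if ψ : ℝ → ℝ³ is differentiable with ψ'(t) = G(ψ(t)) for all t, then the curve t ↦ R(ψ(−t)) also solves the system. -/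
open Real

/-- For `α_s = α_n = π/2`, `R(ψ₁,ψ₂,ψ₃) = (ψ₃,ψ₂,ψ₁)` is a time-reversing symmetry:
`G ∘ R = − R ∘ G`, and if `ψ(t)` solves the system, so does `R(ψ(−t))`. -/
theorem stmt11 (Ks Kn : ℝ) :
    (∀ ψ1 ψ2 ψ3 : ℝ,
      G1 Ks Kn (π/2) (π/2) ψ3 ψ2 ψ1 = -(G3 Ks Kn (π/2) (π/2) ψ1 ψ2 ψ3) ∧
      G2 Ks Kn (π/2) (π/2) ψ3 ψ2 ψ1 = -(G2 Ks Kn (π/2) (π/2) ψ1 ψ2 ψ3) ∧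
      G3 Ks Kn (π/2) (π/2) ψ3 ψ2 ψ1 = -(G1 Ks Kn (π/2) (π/2) ψ1 ψ2 ψ3)) ∧
    (∀ p1 p2 p3 : ℝ → ℝ,
      (∀ t, HasDerivAt p1 (G1 Ks Kn (π/2) (π/2) (p1 t) (p2 t) (p3 t)) t) →
      (∀ t, HasDerivAt p2 (G2 Ks Kn (π/2) (π/2) (p1 t) (p2 t) (p3 t)) t) →
      (∀ t, HasDerivAt p3 (G3 Ks Kn (π/2) (π/2) (p1 t) (p2 t) (p3 t)) t) →
      ∀ t : ℝ,
        HasDerivAt (fun s => p3 (-s))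
          (G1 Ks Kn (π/2) (π/2) (p3 (-t)) (p2 (-t)) (p1 (-t))) t ∧
        HasDerivAt (fun s => p2 (-s))
          (G2 Ks Kn (π/2) (π/2) (p3 (-t)) (p2 (-t)) (p1 (-t))) t ∧
        HasDerivAt (fun s => p1 (-s))
          (G3 Ks Kn (π/2) (π/2) (p3 (-t)) (p2 (-t)) (p1 (-t))) t) := by
  have key : ∀ ψ1 ψ2 ψ3 : ℝ,
      G1 Ks Kn (π/2) (π/2) ψ3 ψ2 ψ1 = -(G3 Ks Kn (π/2) (π/2) ψ1 ψ2 ψ3) ∧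
      G2 Ks Kn (π/2) (π/2) ψ3 ψ2 ψ1 = -(G2 Ks Kn (π/2) (π/2) ψ1 ψ2 ψ3) ∧
      G3 Ks Kn (π/2) (π/2) ψ3 ψ2 ψ1 = -(G1 Ks Kn (π/2) (π/2) ψ1 ψ2 ψ3) := by
    intro a b c
    refine ⟨?_, ?_, ?_⟩ <;>
    · simp only [G1, G2, G3, Real.sin_add, Real.sin_sub, Real.cos_add, Real.cos_sub,
        Real.sin_pi_div_two, Real.cos_pi_div_two]
      ring
  have rev : ∀ (p : ℝ → ℝ) (d t : ℝ), HasDerivAt p d (-t) →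
      HasDerivAt (fun s => p (-s)) (-d) t := by
    intro p d t h
    have h2 := HasDerivAt.comp t h (hasDerivAt_neg t)
    rw [mul_neg_one] at h2
    exact h2
  refine ⟨key, fun p1 p2 p3 h1 h2 h3 t => ?_⟩
  obtain ⟨k1, k2, k3⟩ := key (p1 (-t)) (p2 (-t)) (p3 (-t))
  rw [k1, k2, k3]
  exact ⟨rev _ _ _ (h3 _), rev _ _ _ (h2 _), rev _ _ _ (h1 _)⟩
end

section
/- For arbitrary real parameters K_s, K_n, α_s, α_n, the 3×3 Jacobian matrix J of the vector field G at the synchronized equilibrium SS₀ = (0,0,0) (with entries J_{ij} = ∂G_i/∂ψ_j evaluated at (0,0,0)) has characteristic polynomial (X + K_n·cos(α_n))·(X + (1/2)·K_n·cos(α_n) + (1/2)·K_s·cos(α_s))²; that is, its eigenvalues are −K_n·cos(α_n) (simple) and −(1/2)·K_n·cos(α_n) − (1/2)·K_s·cos(α_s) (with multiplicity two). -/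
open Real

theorem deriv_aux {f : ℝ → ℝ} (A B C : ℝ)
    (h : ∀ x, f x = A * Real.sin x + B * Real.cos x + C) : deriv f 0 = A := by
  have e : f = fun x => A * Real.sin x + B * Real.cos x + C := funext h
  have := (((Real.hasDerivAt_sin 0).const_mul A).add
    ((Real.hasDerivAt_cos 0).const_mul B)).add_const C
  rw [e]
  simpa using this.deriv

open Polynomial in
/-- The Jacobian of `G` at `SS₀ = (0,0,0)` has characteristic polynomial
`(X + K_n cos α_n)·(X + ½K_n cos α_n + ½K_s cos α_s)²`. -/
theorem stmt14 (Ks Kn as an : ℝ) :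
    (!![deriv (fun x => G1 Ks Kn as an x 0 0) 0,
        deriv (fun x => G1 Ks Kn as an 0 x 0) 0,
        deriv (fun x => G1 Ks Kn as an 0 0 x) 0;
        deriv (fun x => G2 Ks Kn as an x 0 0) 0,
        deriv (fun x => G2 Ks Kn as an 0 x 0) 0,
        deriv (fun x => G2 Ks Kn as an 0 0 x) 0;
        deriv (fun x => G3 Ks Kn as an x 0 0) 0,
        deriv (fun x => G3 Ks Kn as an 0 x 0) 0,
        deriv (fun x => G3 Ks Kn as an 0 0 x) 0] : Matrix (Fin 3) (Fin 3) ℝ).charpoly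
      = (X + C (Kn * Real.cos an)) *
          (X + C ((1/2) * Kn * Real.cos an + (1/2) * Ks * Real.cos as)) ^ 2 := by
  have h0 := deriv_aux (f := fun x => G1 Ks Kn as an x 0 0) (-(Ks*Real.cos as/2) - Kn*Real.cos an/2) (-(Kn*Real.sin an/2)) (Kn*Real.sin an/2) (by
    intro x
    simp only [G1, add_zero, sub_zero, zero_add, Real.sin_add, Real.sin_sub, Real.sin_zero, Real.cos_zero]
    ring)
  have h1 := deriv_aux (f := fun x => G1 Ks Kn as an 0 x 0) 0 0 0 (by
    intro x
    simp only [G1, add_zero, sub_zero, zero_add, Real.sin_add, Real.sin_sub, Real.sin_zero, Real.cos_zero]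
    ring)
  have h2 := deriv_aux (f := fun x => G1 Ks Kn as an 0 0 x) 0 0 0 (by
    intro x
    simp only [G1, add_zero, sub_zero, zero_add, Real.sin_add, Real.sin_sub, Real.sin_zero, Real.cos_zero]
    ring)
  have h3 := deriv_aux (f := fun x => G2 Ks Kn as an x 0 0) (Ks*Real.cos as/4 - Kn*Real.cos an/4) (-(Ks*Real.sin as/4)+Kn*Real.sin an/4) (Ks*Real.sin as/4-Kn*Real.sin an/4) (by
    intro x
    simp only [G2, add_zero, sub_zero, zero_add, Real.sin_add, Real.sin_sub, Real.sin_zero, Real.cos_zero]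
    ring)
  have h4 := deriv_aux (f := fun x => G2 Ks Kn as an 0 x 0) (-(Kn*Real.cos an)) 0 0 (by
    intro x
    simp only [G2, add_zero, sub_zero, zero_add, Real.sin_add, Real.sin_sub, Real.sin_zero, Real.cos_zero]
    ring)
  have h5 := deriv_aux (f := fun x => G2 Ks Kn as an 0 0 x) (Ks*Real.cos as/4 - Kn*Real.cos an/4) (Ks*Real.sin as/4-Kn*Real.sin an/4) (-(Ks*Real.sin as/4)+Kn*Real.sin an/4) (by
    intro x
    simp only [G2, add_zero, sub_zero, zero_add, Real.sin_add, Real.sin_sub, Real.sin_zero, Real.cos_zero]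
    ring)
  have h6 := deriv_aux (f := fun x => G3 Ks Kn as an x 0 0) 0 0 0 (by
    intro x
    simp only [G3, add_zero, sub_zero, zero_add, Real.sin_add, Real.sin_sub, Real.sin_zero, Real.cos_zero]
    ring)
  have h7 := deriv_aux (f := fun x => G3 Ks Kn as an 0 x 0) 0 0 0 (by
    intro x
    simp only [G3, add_zero, sub_zero, zero_add, Real.sin_add, Real.sin_sub, Real.sin_zero, Real.cos_zero]
    ring)
  have h8 := deriv_aux (f := fun x => G3 Ks Kn as an 0 0 x) (-(Ks*Real.cos as/2) - Kn*Real.cos an/2) (Kn*Real.sin an/2) (-(Kn*Real.sin an/2)) (by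
    intro x
    simp only [G3, add_zero, sub_zero, zero_add, Real.sin_add, Real.sin_sub, Real.sin_zero, Real.cos_zero]
    ring)
  rw [h0, h1, h2, h3, h4, h5, h6, h7, h8]
  rw [Matrix.charpoly, Matrix.det_fin_three]
  simp [Matrix.charmatrix_apply]
  have e2 : (C (2:ℝ)⁻¹ : ℝ[X]) * 2 = 1 := by
    rw [← C_ofNat, ← C_mul]; norm_num
  simp only [div_eq_mul_inv, C_mul]
  ring
end

section
/- For arbitrary real parameters K_s, K_n, α_s, α_n, the 3×3 Jacobian matrix J of the vector field G at the anti-phase equilibrium SS_π = (0,π,0) (with entries J_{ij} = ∂G_i/∂ψ_j evaluated at (0,π,0)) has characteristic polynomial (X − K_n·cos(α_n))·(X − (1/2)·K_n·cos(α_n) + (1/2)·K_s·cos(α_s))²; that is, its eigenvalues are K_n·cos(α_n) (simple) and (1/2)·K_n·cos(α_n) − (1/2)·K_s·cos(α_s) (with multiplicity two). -/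
theorem deriv_trig (f : ℝ → ℝ) (A B D t : ℝ)
    (h : ∀ x, f x = A * Real.sin x + B * Real.cos x + D) :
    deriv f t = A * Real.cos t - B * Real.sin t := by
  have hf : f = fun x => A * Real.sin x + B * Real.cos x + D := funext h
  rw [hf]
  have := (((Real.hasDerivAt_sin t).const_mul A).add
    ((Real.hasDerivAt_cos t).const_mul B)).add_const D
  refine HasDerivAt.deriv (this.congr_deriv ?_)
  ring


open Real

open Polynomial in
/-- The Jacobian of `G` at `SS_π = (0,π,0)` has characteristic polynomial
`(X − K_n cos α_n)·(X − ½K_n cos α_n + ½K_s cos α_s)²`. -/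
theorem stmt15 (Ks Kn as an : ℝ) :
    (!![deriv (fun x => G1 Ks Kn as an x π 0) 0,
        deriv (fun x => G1 Ks Kn as an 0 x 0) π,
        deriv (fun x => G1 Ks Kn as an 0 π x) 0;
        deriv (fun x => G2 Ks Kn as an x π 0) 0,
        deriv (fun x => G2 Ks Kn as an 0 x 0) π,
        deriv (fun x => G2 Ks Kn as an 0 π x) 0;
        deriv (fun x => G3 Ks Kn as an x π 0) 0,
        deriv (fun x => G3 Ks Kn as an 0 x 0) π,
        deriv (fun x => G3 Ks Kn as an 0 π x) 0] : Matrix (Fin 3) (Fin 3) ℝ).charpoly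
      = (X - C (Kn * Real.cos an)) *
          (X - C ((1/2) * Kn * Real.cos an - (1/2) * Ks * Real.cos as)) ^ 2 := by
  have h0 := deriv_trig (fun x => G1 Ks Kn as an x π 0) (-(Ks/2)*Real.cos as+Kn/2*Real.cos an) (Kn/2*Real.sin an) (-(Kn/2)*Real.sin an) 0 (by
    intro x
    simp only [G1, Real.sin_add, Real.cos_add, Real.sin_sub, Real.cos_sub, Real.sin_pi,
      Real.cos_pi, Real.sin_zero, Real.cos_zero]
    ring)
  have h1 := deriv_trig (fun x => G1 Ks Kn as an 0 x 0) (0) (0) (0) π (by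
    intro x
    simp only [G1, Real.sin_add, Real.cos_add, Real.sin_sub, Real.cos_sub, Real.sin_pi,
      Real.cos_pi, Real.sin_zero, Real.cos_zero]
    ring)
  have h2 := deriv_trig (fun x => G1 Ks Kn as an 0 π x) (0) (0) (0) 0 (by
    intro x
    simp only [G1, Real.sin_add, Real.cos_add, Real.sin_sub, Real.cos_sub, Real.sin_pi,
      Real.cos_pi, Real.sin_zero, Real.cos_zero]
    ring)
  have h3 := deriv_trig (fun x => G2 Ks Kn as an x π 0) (Ks/4*Real.cos as+Kn/4*Real.cos an) (-(Ks/4)*Real.sin as-Kn/4*Real.sin an) (Ks/4*Real.sin as+Kn/4*Real.sin an) 0 (by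
    intro x
    simp only [G2, Real.sin_add, Real.cos_add, Real.sin_sub, Real.cos_sub, Real.sin_pi,
      Real.cos_pi, Real.sin_zero, Real.cos_zero]
    ring)
  have h4 := deriv_trig (fun x => G2 Ks Kn as an 0 x 0) (-Kn*Real.cos an) (0) (0) π (by
    intro x
    simp only [G2, Real.sin_add, Real.cos_add, Real.sin_sub, Real.cos_sub, Real.sin_pi,
      Real.cos_pi, Real.sin_zero, Real.cos_zero]
    ring)
  have h5 := deriv_trig (fun x => G2 Ks Kn as an 0 π x) (Ks/4*Real.cos as+Kn/4*Real.cos an) (Ks/4*Real.sin as+Kn/4*Real.sin an) (-(Ks/4)*Real.sin as-Kn/4*Real.sin an) 0 (by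
    intro x
    simp only [G2, Real.sin_add, Real.cos_add, Real.sin_sub, Real.cos_sub, Real.sin_pi,
      Real.cos_pi, Real.sin_zero, Real.cos_zero]
    ring)
  have h6 := deriv_trig (fun x => G3 Ks Kn as an x π 0) (0) (0) (0) 0 (by
    intro x
    simp only [G3, Real.sin_add, Real.cos_add, Real.sin_sub, Real.cos_sub, Real.sin_pi,
      Real.cos_pi, Real.sin_zero, Real.cos_zero]
    ring)
  have h7 := deriv_trig (fun x => G3 Ks Kn as an 0 x 0) (0) (0) (0) π (by
    intro x
    simp only [G3, Real.sin_add, Real.cos_add, Real.sin_sub, Real.cos_sub, Real.sin_pi,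
      Real.cos_pi, Real.sin_zero, Real.cos_zero]
    ring)
  have h8 := deriv_trig (fun x => G3 Ks Kn as an 0 π x) (-(Ks/2)*Real.cos as+Kn/2*Real.cos an) (-(Kn/2)*Real.sin an) (Kn/2*Real.sin an) 0 (by
    intro x
    simp only [G3, Real.sin_add, Real.cos_add, Real.sin_sub, Real.cos_sub, Real.sin_pi,
      Real.cos_pi, Real.sin_zero, Real.cos_zero]
    ring)
  rw [h0, h1, h2, h3, h4, h5, h6, h7, h8]
  simp only [Real.sin_pi, Real.cos_pi, Real.sin_zero, Real.cos_zero]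
  have e : (1:ℝ)/2 * Kn * Real.cos an - 1/2 * Ks * Real.cos as
      = -(Ks/2) * Real.cos as + Kn/2 * Real.cos an := by ring
  rw [e]
  simp [Matrix.charpoly, Matrix.det_fin_three, Matrix.charmatrix_apply]
  ring
end

section
/- For arbitrary real parameters K_s, K_n, α_s, α_n, the lines I₁ = {(φ, π−φ, φ) : φ ∈ ℝ} and I₂ = {(φ, π, −φ) : φ ∈ ℝ} are invariant under the flow of ψ' = G(ψ), and the induced dynamics on each is φ̇ = (1/2)·(K_n·cos(α_n) − K_s·cos(α_s))·sin(φ); explicitly, for every φ ∈ ℝ, G(φ, π−φ, φ) = c·sin(φ)·(1, −1, 1) and G(φ, π, −φ) = c·sin(φ)·(1, 0, −1), where c = (1/2)·(K_n·cos(α_n) − K_s·cos(α_s)). In particular, if K_s·cos(α_s) = K_n·cos(α_n), every point of I₁ and I₂ is an equilibrium. -/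
open Real

/-- The lines `I₁ = {(φ, π−φ, φ)}` and `I₂ = {(φ, π, −φ)}` are invariant, with induced
dynamics `φ' = ½(K_n cos α_n − K_s cos α_s)·sin φ`; if `K_s cos α_s = K_n cos α_n` every
point of `I₁` and `I₂` is an equilibrium. -/
theorem stmt16 (Ks Kn as an : ℝ) :
    (∀ φ : ℝ,
      G1 Ks Kn as an φ (π - φ) φ
          = (1/2) * (Kn * Real.cos an - Ks * Real.cos as) * Real.sin φ * 1 ∧
      G2 Ks Kn as an φ (π - φ) φ
          = (1/2) * (Kn * Real.cos an - Ks * Real.cos as) * Real.sin φ * (-1) ∧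
      G3 Ks Kn as an φ (π - φ) φ
          = (1/2) * (Kn * Real.cos an - Ks * Real.cos as) * Real.sin φ * 1 ∧
      G1 Ks Kn as an φ π (-φ)
          = (1/2) * (Kn * Real.cos an - Ks * Real.cos as) * Real.sin φ * 1 ∧
      G2 Ks Kn as an φ π (-φ)
          = (1/2) * (Kn * Real.cos an - Ks * Real.cos as) * Real.sin φ * 0 ∧
      G3 Ks Kn as an φ π (-φ)
          = (1/2) * (Kn * Real.cos an - Ks * Real.cos as) * Real.sin φ * (-1)) ∧
    (Ks * Real.cos as = Kn * Real.cos an →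
      ∀ φ : ℝ,
        G1 Ks Kn as an φ (π - φ) φ = 0 ∧
        G2 Ks Kn as an φ (π - φ) φ = 0 ∧
        G3 Ks Kn as an φ (π - φ) φ = 0 ∧
        G1 Ks Kn as an φ π (-φ) = 0 ∧
        G2 Ks Kn as an φ π (-φ) = 0 ∧
        G3 Ks Kn as an φ π (-φ) = 0) := by
  have main : ∀ φ : ℝ,
      G1 Ks Kn as an φ (π - φ) φ
          = (1/2) * (Kn * Real.cos an - Ks * Real.cos as) * Real.sin φ * 1 ∧
      G2 Ks Kn as an φ (π - φ) φ
          = (1/2) * (Kn * Real.cos an - Ks * Real.cos as) * Real.sin φ * (-1) ∧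
      G3 Ks Kn as an φ (π - φ) φ
          = (1/2) * (Kn * Real.cos an - Ks * Real.cos as) * Real.sin φ * 1 ∧
      G1 Ks Kn as an φ π (-φ)
          = (1/2) * (Kn * Real.cos an - Ks * Real.cos as) * Real.sin φ * 1 ∧
      G2 Ks Kn as an φ π (-φ)
          = (1/2) * (Kn * Real.cos an - Ks * Real.cos as) * Real.sin φ * 0 ∧
      G3 Ks Kn as an φ π (-φ)
          = (1/2) * (Kn * Real.cos an - Ks * Real.cos as) * Real.sin φ * (-1) := by
    intro φ
    refine ⟨?_, ?_, ?_, ?_, ?_, ?_⟩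
    · unfold G1
      rw [show an + (π - φ) = (an - φ) + π by ring, show an + φ + (π - φ) = an + π by ring,
        show an - φ + π + φ = an + π by ring, show an + π + φ = (an + φ) + π by ring]
      simp only [sin_add_pi, sin_add, sin_sub, sin_pi, cos_pi]
      ring
    · unfold G2
      rw [show an - φ - (π - φ) = an - π by ring, show an + (π - φ) + φ = an + π by ring]
      simp only [sin_add_pi, sin_sub_pi, sin_pi_sub, sin_add, sin_sub, sin_pi, cos_pi]
      ring
    · unfold G3
      rw [show an - (π - φ) = (an + φ) - π by ring, show an - φ - (π - φ) = an - π by ring,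
        show an + φ - π - φ = an - π by ring, show an - π - φ = (an - φ) - π by ring]
      simp only [sin_sub_pi, sin_add, sin_sub, sin_pi, cos_pi]
      ring
    · unfold G1
      rw [show an + π + -φ = (an - φ) + π by ring, show an + φ + π + -φ = an + π by ring]
      simp only [sin_add_pi, sin_add, sin_sub, sin_pi, cos_pi]
      ring
    · unfold G2
      rw [show an + π + -φ = (an - φ) + π by ring, show as + -φ = as - φ by ring]
      simp only [sin_add_pi, sin_sub_pi, sin_pi]
      ring
    · unfold G3
      rw [show an - π - -φ = (an + φ) - π by ring, show an - φ - π - -φ = an - π by ring]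
      simp only [sin_sub_pi, sin_neg, sin_add, sin_sub, sin_pi, cos_pi]
      ring
  refine ⟨main, fun h φ => ?_⟩
  have hm := main φ
  rw [h] at hm
  simpa only [sub_self, mul_zero, zero_mul] using hm
end

section
/- Suppose α_s = α_n = π/2 (K_s and K_n arbitrary real numbers). Then the lines S₁ = {(φ, 0, −φ) : φ ∈ ℝ} and S₂ = {(φ, −φ, φ) : φ ∈ ℝ} consist entirely of equilibria of the system ψ' = G(ψ): for every φ ∈ ℝ, G(φ, 0, −φ) = (0,0,0) and G(φ, −φ, φ) = (0,0,0). -/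
open Real

/-- For `α_s = α_n = π/2` the lines `S₁ = {(φ, 0, −φ)}` and `S₂ = {(φ, −φ, φ)}` consist
entirely of equilibria. -/
theorem stmt19 (Ks Kn : ℝ) (φ : ℝ) :
    (G1 Ks Kn (π/2) (π/2) φ 0 (-φ) = 0 ∧
     G2 Ks Kn (π/2) (π/2) φ 0 (-φ) = 0 ∧
     G3 Ks Kn (π/2) (π/2) φ 0 (-φ) = 0) ∧
    (G1 Ks Kn (π/2) (π/2) φ (-φ) φ = 0 ∧
     G2 Ks Kn (π/2) (π/2) φ (-φ) φ = 0 ∧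
     G3 Ks Kn (π/2) (π/2) φ (-φ) φ = 0) := by
  have e : ∀ x y : ℝ, x = π/2 + y → Real.sin x = Real.cos y := by
    intro x y h
    rw [h, add_comm, Real.sin_add_pi_div_two]
  have e0 : ∀ x : ℝ, x = π/2 → Real.sin x = 1 := by
    intro x h
    rw [h, Real.sin_pi_div_two]
  have en : ∀ x : ℝ, x = π/2 - φ → Real.sin x = Real.cos φ := by
    intro x h
    rw [h, Real.sin_pi_div_two_sub]
  refine ⟨⟨?_, ?_, ?_⟩, ⟨?_, ?_, ?_⟩⟩
  · unfold G1
    rw [e0 (π/2 + 0) (by ring), e (π/2 + φ + 0) φ (by ring), en (π/2 + 0 + -φ) (by ring),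
      e0 (π/2 + φ + 0 + -φ) (by ring), Real.cos_pi_div_two]
    ring
  · unfold G2
    rw [en (π/2 + -φ) (by ring), en (π/2 - φ) (by ring), en (π/2 - φ - 0) (by ring),
      en (π/2 + 0 + -φ) (by ring), Real.cos_pi_div_two]
    ring
  · unfold G3
    rw [e0 (π/2 - 0) (by ring), en (π/2 - φ - 0) (by ring), e (π/2 - 0 - -φ) φ (by ring),
      e0 (π/2 - φ - 0 - -φ) (by ring), Real.cos_pi_div_two]
    ring
  · unfold G1
    rw [en (π/2 + -φ) (by ring), e0 (π/2 + φ + -φ) (by ring), e0 (π/2 + -φ + φ) (by ring),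
      e (π/2 + φ + -φ + φ) φ (by ring), Real.cos_pi_div_two]
    ring
  · unfold G2
    rw [e (π/2 + φ) φ (by ring), en (π/2 - φ) (by ring), e0 (π/2 - φ - -φ) (by ring),
      e0 (π/2 + -φ + φ) (by ring), Real.cos_pi_div_two]
    ring
  · unfold G3
    rw [e (π/2 - -φ) φ (by ring), e0 (π/2 - φ - -φ) (by ring), e0 (π/2 - -φ - φ) (by ring),
      en (π/2 - φ - -φ - φ) (by ring), Real.cos_pi_div_two]
    ring
end
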